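/- Let k ≥ 1, v = 2k, R = F_2[U, U^{-1}], and let M be the model complex C̄_1: the free R-module with basis {a, b, c, e, z_0} ∪ {z_r^s : 1 ≤ r ≤ v, s ∈ {1,2}}, with R-linear differential ∂ given by ∂a = b + c, ∂b = ∂c = U·e, ∂z_1^s = z_0 + z_2^s, ∂z_r^s = z_{r-1}^s + z_{r+1}^s for odd r with 1 < r ≤ v-1, and ∂ = 0 on e, z_0, and z_r^s for even r. Then the homology ker(∂)/range(∂) is a free R-module of rank one, generated by the class of z_0. -/

import Mathlib

/- The homology of the dual model complex C̄₁ is a free R-module of rank one, generated by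
the class of z₀. -/

open LaurentPolynomial

/-- `R2` is the Laurent polynomial ring `F₂[U, U⁻¹]`. -/
abbrev R2 : Type := LaurentPolynomial (ZMod 2)

/-- The variable `U`. -/
noncomputable def U : R2 := T 1

/-- Basis `{a, b, c, e, z_0} ∪ {z_r^s : 1 ≤ r ≤ v, s ∈ {1,2}}` of the dual model complex
`C̄₁`. -/
inductive ModelB (v : ℕ) : Type
  | a | b | c | e | z0 | z (s : Fin 2) (r : Fin v)
  deriving DecidableEq

/-- The basis vector `z_r^{s+1}` for `1 ≤ r ≤ v`, extended by `0` outside that range. -/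
noncomputable def zS (v : ℕ) (s : Fin 2) (r : ℕ) : ModelB v → R2 :=
  if h : 1 ≤ r ∧ r ≤ v then Pi.single (ModelB.z s ⟨r - 1, by omega⟩) 1 else 0

instance ModelB.instFinite (v : ℕ) : Finite (ModelB v) := by
  refine Finite.of_surjective
    (fun x : Fin 5 ⊕ (Fin 2 × Fin v) =>
      x.elim ![ModelB.a, ModelB.b, ModelB.c, ModelB.e, ModelB.z0] fun p => ModelB.z p.1 p.2) ?_
  rintro (_ | _ | _ | _ | _ | ⟨s, r⟩)
  exacts [⟨.inl 0, rfl⟩, ⟨.inl 1, rfl⟩, ⟨.inl 2, rfl⟩, ⟨.inl 3, rfl⟩, ⟨.inl 4, rfl⟩,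
    ⟨.inr (s, r), rfl⟩]

namespace ModelB

variable {v : ℕ} {N : Type*} [AddCommGroup N] [Module R2 N]

/-- Linear maps out of the model complex agree if they agree on its basis vectors. -/
theorem linearMap_ext {f g : (ModelB v → R2) →ₗ[R2] N}
    (ha : f (Pi.single a 1) = g (Pi.single a 1)) (hb : f (Pi.single b 1) = g (Pi.single b 1))
    (hc : f (Pi.single c 1) = g (Pi.single c 1)) (he : f (Pi.single e 1) = g (Pi.single e 1))
    (hz0 : f (Pi.single z0 1) = g (Pi.single z0 1))
    (hz : ∀ s r, 1 ≤ r → r ≤ v → f (zS v s r) = g (zS v s r)) : f = g := by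
  refine (Pi.basisFun R2 (ModelB v)).ext ?_
  rintro (_ | _ | _ | _ | _ | ⟨s, r⟩) <;> rw [Pi.basisFun_apply] <;> try assumption
  have h := hz s (r + 1) (by omega) (by omega)
  rwa [zS, dif_pos ⟨by omega, by omega⟩] at h

/-- The linear map with prescribed values on `a, b, c, e, z_0` and on the `z_r^s`. -/
noncomputable def lift (xa xb xc xe x0 : N) (xz : Fin 2 → ℕ → N) : (ModelB v → R2) →ₗ[R2] N :=
  (Pi.basisFun R2 (ModelB v)).constr R2 fun
    | a => xa
    | b => xb
    | c => xc
    | e => xe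
    | z0 => x0
    | z s r => xz s (r + 1)

section lift

variable (xa xb xc xe x0 : N) (xz : Fin 2 → ℕ → N)

theorem lift_single (i : ModelB v) : lift xa xb xc xe x0 xz (Pi.single i 1) =
    match i with
    | a => xa
    | b => xb
    | c => xc
    | e => xe
    | z0 => x0
    | z s r => xz s (r + 1) := by
  rw [lift, ← Pi.basisFun_apply, Module.Basis.constr_basis]

theorem lift_zS (s : Fin 2) {r : ℕ} (h₁ : 1 ≤ r) (h₂ : r ≤ v) :
    lift xa xb xc xe x0 xz (zS v s r) = xz s r := by
  rw [zS, dif_pos ⟨h₁, h₂⟩, lift_single]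
  simp only [Nat.sub_add_cancel h₁]

end lift

/-- The augmentation sending `z_0` and every `z_r^s` with `r` even to `1`, and all other basis
vectors to `0`. -/
noncomputable def augmentation (v : ℕ) : (ModelB v → R2) →ₗ[R2] R2 :=
  lift 0 0 0 0 1 fun _ r => if Even r then 1 else 0

/-- The homotopy with `c ↦ a`, `e ↦ U⁻¹ b`, `z_{2j}^s ↦ z_1^s + z_3^s + ⋯ + z_{2j-1}^s`, and all
other basis vectors sent to `0`. -/
noncomputable def homotopy (v : ℕ) : (ModelB v → R2) →ₗ[R2] (ModelB v → R2) :=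
  lift 0 0 (Pi.single a 1) ((T (-1) : R2) • Pi.single b 1) 0 fun s r =>
    if Even r then ∑ i ∈ Finset.range (r / 2), zS v s (2 * i + 1) else 0

/-- Every module over `F₂[U, U⁻¹]` has characteristic two. -/
theorem add_self (x : N) : x + x = 0 := by
  have h : (2 : R2) = 0 := by
    rw [← map_ofNat (LaurentPolynomial.C (R := ZMod 2)) 2,
      show (OfNat.ofNat 2 : ZMod 2) = 0 from rfl, map_zero]
  rw [← two_smul R2 x, h, zero_smul]

end ModelB

/-- Let `M` be the dual model complex `C̄₁` (`v = 2k`, `k ≥ 1`), the free `R2`-module on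
`{a,b,c,e,z_0} ∪ {z_r^s}` with differential `∂a = b + c`, `∂b = ∂c = U • e`,
`∂z_1^s = z_0 + z_2^s`, `∂z_r^s = z_{r-1}^s + z_{r+1}^s` for odd `r` with `1 < r ≤ v - 1`,
and `∂ = 0` on `e`, `z_0`, and `z_r^s` for even `r`. Then the homology `ker ∂ / range ∂`
is a free `R2`-module of rank one generated by the class of `z_0`. -/
theorem modelC1dual_homology (k : ℕ) (hk : 1 ≤ k) (v : ℕ) (hv : v = 2 * k)
    (d : (ModelB v → R2) →ₗ[R2] (ModelB v → R2))
    (hda : d (Pi.single ModelB.a 1) = Pi.single ModelB.b 1 + Pi.single ModelB.c 1)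
    (hdb : d (Pi.single ModelB.b 1) = U • (Pi.single ModelB.e 1 : ModelB v → R2))
    (hdc : d (Pi.single ModelB.c 1) = U • (Pi.single ModelB.e 1 : ModelB v → R2))
    (hdz1 : ∀ s : Fin 2, d (zS v s 1) = Pi.single ModelB.z0 1 + zS v s 2)
    (hdzodd : ∀ s : Fin 2, ∀ r : ℕ, 1 < r → r ≤ v - 1 → Odd r →
      d (zS v s r) = zS v s (r - 1) + zS v s (r + 1))
    (hde : d (Pi.single ModelB.e 1) = 0)
    (hdz0 : d (Pi.single ModelB.z0 1) = 0)
    (hdzeven : ∀ s : Fin 2, ∀ r : ℕ, 1 ≤ r → r ≤ v → Even r → d (zS v s r) = 0) :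
    d ∘ₗ d = 0 ∧
    (Pi.single ModelB.z0 1 : ModelB v → R2) ∈ LinearMap.ker d ∧
    (∀ x ∈ LinearMap.ker d, ∃ c : R2,
      x + c • (Pi.single ModelB.z0 1 : ModelB v → R2) ∈ LinearMap.range d) ∧
    (∀ c : R2, c • (Pi.single ModelB.z0 1 : ModelB v → R2) ∈ LinearMap.range d → c = 0) := by
  have hodd (s : Fin 2) (j : ℕ) (hj : j + 1 < k) :
      d (zS v s (2 * (j + 1) + 1)) = zS v s (2 * (j + 1)) + zS v s (2 * (j + 2)) :=
    hdzodd s _ (by omega) (by omega) ⟨j + 1, rfl⟩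
  have heven (s : Fin 2) (j : ℕ) (hj : j < k) : d (zS v s (2 * (j + 1))) = 0 :=
    hdzeven s _ (by omega) (by omega) (even_two_mul _)
  have hεeven (s : Fin 2) (j : ℕ) (hj : j < k) :
      ModelB.augmentation v (zS v s (2 * (j + 1))) = 1 := by
    rw [ModelB.augmentation, ModelB.lift_zS _ _ _ _ _ _ s (by omega) (by omega),
      if_pos (even_two_mul _)]
  have hεodd (s : Fin 2) (j : ℕ) (hj : j < k) :
      ModelB.augmentation v (zS v s (2 * j + 1)) = 0 := by
    rw [ModelB.augmentation, ModelB.lift_zS _ _ _ _ _ _ s (by omega) (by omega),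
      if_neg (by simp)]
  have hεz0 : ModelB.augmentation v (Pi.single ModelB.z0 1) = 1 := ModelB.lift_single ..
  have hHeven (s : Fin 2) (j : ℕ) (hj : j < k) :
      ModelB.homotopy v (zS v s (2 * (j + 1))) =
        ∑ i ∈ Finset.range (j + 1), zS v s (2 * i + 1) := by
    rw [ModelB.homotopy, ModelB.lift_zS _ _ _ _ _ _ s (by omega) (by omega),
      if_pos (even_two_mul _), Nat.mul_div_cancel_left _ two_pos]
  have hHodd (s : Fin 2) (j : ℕ) (hj : j < k) :
      ModelB.homotopy v (zS v s (2 * j + 1)) = 0 := by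
    rw [ModelB.homotopy, ModelB.lift_zS _ _ _ _ _ _ s (by omega) (by omega),
      if_neg (by simp)]
  have hparity {P : ℕ → Prop} (ho : ∀ j < k, P (2 * j + 1)) (he : ∀ j < k, P (2 * (j + 1)))
      (r : ℕ) (h₁ : 1 ≤ r) (h₂ : r ≤ v) : P r := by
    obtain ⟨j, rfl | rfl⟩ := r.even_or_odd'
    · obtain _ | j := j
      · omega
      · exact he j (by omega)
    · exact ho j (by omega)
  have hdd : d ∘ₗ d = 0 := by
    refine ModelB.linearMap_ext ?_ ?_ ?_ ?_ ?_ fun s => hparity (fun j hj => ?_) fun j hj => ?_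
    · simp [hda, hdb, hdc, ModelB.add_self]
    · simp [hdb, hde]
    · simp [hdc, hde]
    · simp [hde]
    · simp [hdz0]
    · obtain _ | j := j
      · simpa [hdz1, hdz0] using heven s 0 hj
      · simp [hodd s j hj, heven s j (by omega), heven s (j + 1) hj]
    · simp [heven s j hj]
  have hεd : ModelB.augmentation v ∘ₗ d = 0 := by
    have hb : ModelB.augmentation v (Pi.single ModelB.b 1) = 0 := ModelB.lift_single ..
    have hc : ModelB.augmentation v (Pi.single ModelB.c 1) = 0 := ModelB.lift_single ..
    have he : ModelB.augmentation v (Pi.single ModelB.e 1) = 0 := ModelB.lift_single ..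
    refine ModelB.linearMap_ext ?_ ?_ ?_ ?_ ?_ fun s => hparity (fun j hj => ?_) fun j hj => ?_
    · simp [hda, hb, hc]
    · simp [hdb, he]
    · simp [hdc, he]
    · simp [hde]
    · simp [hdz0]
    · obtain _ | j := j
      · have h := hεeven s 0 hj
        simp only [zero_add, mul_one] at h
        simp [hdz1, hεz0, h, ModelB.add_self (1 : R2)]
      · simp [hodd s j hj, hεeven s j (by omega), hεeven s (j + 1) hj,
          ModelB.add_self (1 : R2)]
    · simp [heven s j hj]
  have hdsum (s : Fin 2) (j : ℕ) (hj : j < k) :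
      d (∑ i ∈ Finset.range (j + 1), zS v s (2 * i + 1)) =
        zS v s (2 * (j + 1)) + Pi.single ModelB.z0 1 := by
    induction j with
    | zero => simp [hdz1, add_comm]
    | succ j ih =>
      rw [Finset.sum_range_succ, map_add, ih (by omega), hodd s j hj, add_add_add_comm,
        add_comm (Pi.single _ _), ← add_assoc, ModelB.add_self, zero_add]
  have hhomotopy : d ∘ₗ ModelB.homotopy v + ModelB.homotopy v ∘ₗ d =
      LinearMap.id + (ModelB.augmentation v).smulRight (Pi.single ModelB.z0 1) := by
    have ha : ModelB.homotopy v (Pi.single ModelB.a 1) = 0 := ModelB.lift_single ..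
    have hb : ModelB.homotopy v (Pi.single ModelB.b 1) = 0 := ModelB.lift_single ..
    have hc : ModelB.homotopy v (Pi.single ModelB.c 1) = Pi.single ModelB.a 1 :=
      ModelB.lift_single ..
    have he : ModelB.homotopy v (Pi.single ModelB.e 1) = (T (-1) : R2) • Pi.single ModelB.b 1 :=
      ModelB.lift_single ..
    have hz0 : ModelB.homotopy v (Pi.single ModelB.z0 1) = 0 := ModelB.lift_single ..
    have hεa : ModelB.augmentation v (Pi.single ModelB.a 1) = 0 := ModelB.lift_single ..
    have hεb : ModelB.augmentation v (Pi.single ModelB.b 1) = 0 := ModelB.lift_single ..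
    have hεc : ModelB.augmentation v (Pi.single ModelB.c 1) = 0 := ModelB.lift_single ..
    have hεe : ModelB.augmentation v (Pi.single ModelB.e 1) = 0 := ModelB.lift_single ..
    have hUT : U * T (-1) = 1 := by rw [U, ← T_add, add_neg_cancel, T_zero]
    have hTU : T (-1) * U = 1 := by rw [mul_comm, hUT]
    refine ModelB.linearMap_ext ?_ ?_ ?_ ?_ ?_ fun s => hparity (fun j hj => ?_) fun j hj => ?_
    all_goals simp only [LinearMap.add_apply, LinearMap.comp_apply, LinearMap.id_apply,
      LinearMap.smulRight_apply]
    · simp only [ha, hda, map_add, hb, hc, hεa, map_zero, zero_add, zero_smul, add_zero]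
    · simp only [hb, hdb, map_smul, he, smul_smul, hUT, one_smul, hεb, map_zero, zero_add,
        zero_smul, add_zero]
    · simp only [hc, hda, hdc, map_smul, he, smul_smul, hUT, one_smul, hεc, zero_smul, add_zero]
      rw [add_right_comm, ModelB.add_self, zero_add]
    · simp only [he, map_smul, hdb, smul_smul, hTU, one_smul, hde, map_zero, hεe, zero_smul]
    · simp only [hz0, hdz0, map_zero, hεz0, one_smul, ModelB.add_self]
    · rw [hHodd s j hj, hεodd s j hj, map_zero, zero_add, zero_smul, add_zero]
      obtain _ | j := j
      · have h := hHeven s 0 hj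
        simp only [zero_add, mul_one] at h
        simp [hdz1, hz0, h]
      · rw [hodd s j hj, map_add, hHeven s j (by omega), hHeven s (j + 1) hj,
          Finset.sum_range_succ _ (j + 1), ← add_assoc, ModelB.add_self, zero_add]
    · rw [hHeven s j hj, hdsum s j hj, heven s j hj, hεeven s j hj, map_zero, add_zero, one_smul]
  refine ⟨hdd, hdz0, fun x hx => ⟨ModelB.augmentation v x, ModelB.homotopy v x, ?_⟩, ?_⟩
  · have h := LinearMap.congr_fun hhomotopy x
    simpa [LinearMap.mem_ker.mp hx] using h
  · rintro c ⟨y, hy⟩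
    have h := LinearMap.congr_fun hεd y
    simpa [hy, hεz0] using h
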